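/- Assume (A1)–(A5), let s* ∈ [s₁, s₂) be the threshold value (so that c*(s) = 2 for s ∈ [0, s*] and c*(s) > 2 for s > s*), and let W* be the minimal traveling wave for parameter s* with speed 2. If lim_{ξ→+∞} W*(ξ)/(ξ e^{−ξ}) = A₀ for some A₀ > 0, then there exist δ₀ > 0 and a continuous function R_w : ℝ → ℝ with R_w(ξ) = O(ξ e^{−ξ}) as ξ → +∞ such that the function W̄(ξ) := min{W*(ξ) − R_w(ξ), 1} is nonnegative and not identically zero, and W̄ is a super-solution in the following sense: there is a finite set S ⊂ ℝ such that W̄ is C² on ℝ∖S and satisfies W̄'' + 2W̄' + f(W̄; s* + δ₀) ≤ 0 on ℝ∖S, while at each ξ₀ ∈ S the one-sided derivatives W̄'(ξ₀⁺) and W̄'(ξ₀⁻) exist and satisfy W̄'(ξ₀⁺) ≤ W̄'(ξ₀⁻). -/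

import Mathlib

open Filter Asymptotics MeasureTheory Set

noncomputable section

/-- A traveling wave front with speed `c` for the nonlinearity `g`. -/
def IsFront (g : ℝ → ℝ) (c : ℝ) (W : ℝ → ℝ) : Prop :=
  ContDiff ℝ 2 W ∧
  (∀ ξ, deriv (deriv W) ξ + c * deriv W ξ + g (W ξ) = 0) ∧
  Tendsto W atBot (nhds 1) ∧ Tendsto W atTop (nhds 0) ∧
  (∀ ξ, deriv W ξ < 0)

lemma bdd_Ici_aux (h : ℝ → ℝ) (hc : Continuous h) (hb : ∃ C, ∀ᶠ x in atTop, |h x| ≤ C) (b : ℝ) :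
    ∃ C, 0 < C ∧ ∀ x, b ≤ x → |h x| ≤ C := by
  obtain ⟨C, hC⟩ := hb
  obtain ⟨N, hN⟩ := eventually_atTop.1 hC
  obtain ⟨D, hD⟩ := (isCompact_Icc (a := b) (b := N)).exists_bound_of_continuousOn hc.continuousOn
  refine ⟨max (max C D) 1, by positivity, fun x hx => ?_⟩
  rcases le_total N x with h1 | h1
  · exact (hN x h1).trans ((le_max_left _ _).trans (le_max_left _ _))
  · exact (hD x ⟨hx, h1⟩).trans ((le_max_right _ _).trans (le_max_left _ _))

lemma bdd_of_deriv_aux (h h1 E e : ℝ → ℝ) (N : ℝ) (hh : ∀ x, N ≤ x → HasDerivAt h (h1 x) x)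
    (hE : ∀ x, N ≤ x → HasDerivAt E (-e x) x) (hle : ∀ x, N ≤ x → |h1 x| ≤ e x)
    (hE0 : ∀ x, N ≤ x → 0 ≤ E x) : ∀ x, N ≤ x → |h x| ≤ |h N| + E N := by
  have hanti : AntitoneOn (fun x => h x + E x) (Ici N) := by
    apply antitoneOn_of_hasDerivWithinAt_nonpos (f' := fun x => h1 x + -e x) (convex_Ici N)
    · intro x hx
      exact ((hh x hx).add (hE x hx)).continuousAt.continuousWithinAt
    · intro x hx
      rw [interior_Ici] at hx
      exact ((hh x (le_of_lt hx)).add (hE x (le_of_lt hx))).hasDerivWithinAt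
    · intro x hx
      rw [interior_Ici] at hx
      have := (abs_le.1 (hle x (le_of_lt hx))).2
      linarith
  have hmono : MonotoneOn (fun x => h x - E x) (Ici N) := by
    apply monotoneOn_of_hasDerivWithinAt_nonneg (f' := fun x => h1 x - -e x) (convex_Ici N)
    · intro x hx
      exact ((hh x hx).sub (hE x hx)).continuousAt.continuousWithinAt
    · intro x hx
      rw [interior_Ici] at hx
      exact ((hh x (le_of_lt hx)).sub (hE x (le_of_lt hx))).hasDerivWithinAt
    · intro x hx
      rw [interior_Ici] at hx
      have := (abs_le.1 (hle x (le_of_lt hx))).1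
      linarith
  intro x hx
  have a1 := hanti (mem_Ici.2 le_rfl) hx hx
  have a2 := hmono (mem_Ici.2 le_rfl) hx hx
  simp only at a1 a2
  have := hE0 x hx
  have := le_abs_self (h N)
  have := neg_abs_le (h N)
  rw [abs_le]
  constructor <;> linarith

lemma taylor_aux (h h1 h2 : ℝ → ℝ) (K : ℝ) 
    (hh : ∀ x ∈ Icc (0:ℝ) 1, HasDerivWithinAt h (h1 x) (Icc 0 1) x)
    (hh1 : ∀ x ∈ Icc (0:ℝ) 1, HasDerivWithinAt h1 (h2 x) (Icc 0 1) x)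
    (hK : ∀ x ∈ Icc (0:ℝ) 1, |h2 x| ≤ K) :
    ∀ x ∈ Icc (0:ℝ) 1, ∀ y ∈ Icc (0:ℝ) 1, |h y - h x - h1 x * (y - x)| ≤ K * (y - x)^2 := by
  have hK0 : 0 ≤ K := (abs_nonneg _).trans (hK 0 (by simp))
  have lip : ∀ x ∈ Icc (0:ℝ) 1, ∀ y ∈ Icc (0:ℝ) 1, |h1 y - h1 x| ≤ K * |y - x| := by
    intro x hx y hy
    exact Convex.norm_image_sub_le_of_norm_hasDerivWithin_le hh1 hK (convex_Icc 0 1) hx hy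
  intro x hx y hy
  have hsub : uIcc x y ⊆ Icc (0:ℝ) 1 := (convex_Icc (0:ℝ) 1).ordConnected.uIcc_subset hx hy
  have key := Convex.norm_image_sub_le_of_norm_hasDerivWithin_le (f := fun z => h z - h1 x * z)
    (f' := fun z => h1 z - h1 x) (s := uIcc x y) (x := x) (y := y) (C := K * |y - x|)
    (fun z hz => by
      exact (((hh z (hsub hz)).mono hsub).sub
        ((hasDerivWithinAt_id z _).const_mul (h1 x))).congr_deriv (by simp))
    (fun z hz => by
      refine (lip x hx z (hsub hz)).trans ?_
      refine mul_le_mul_of_nonneg_left ?_ hK0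
      exact Set.abs_sub_left_of_mem_uIcc hz)
    (convex_uIcc x y) left_mem_uIcc right_mem_uIcc
  simp only [Real.norm_eq_abs] at key
  have e : K * |y - x| * |y - x| = K * (y-x)^2 := by rw [mul_assoc, ← sq, sq_abs]
  rw [e] at key
  convert key using 2
  ring

lemma pow_exp_aux (n : ℕ) : Tendsto (fun x : ℝ => x^n * Real.exp (-x/2)) atTop (nhds 0) := by
  have := Real.tendsto_pow_mul_exp_neg_atTop_nhds_zero n
  have h2 := this.comp (tendsto_id.atTop_div_const (show (0:ℝ) < 2 by norm_num))
  have h3 := h2.const_mul ((2:ℝ)^n)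
  rw [mul_zero] at h3
  refine h3.congr fun x => ?_
  simp only [Function.comp, id]
  rw [div_pow]
  field_simp

lemma asym_aux (g W W1 : ℝ → ℝ) (K A₀ : ℝ) (hW : ∀ x, HasDerivAt W (W1 x) x)
    (hW1 : ∀ x, HasDerivAt W1 (-2 * W1 x - g (W x)) x)
    (hg : ∀ w ∈ Icc (0:ℝ) 1, |g w - w| ≤ K * w^2) (hK : 0 ≤ K)
    (hm : ∀ x, W x ∈ Ioo (0:ℝ) 1)
    (hlim : Tendsto (fun ξ => W ξ / (ξ * Real.exp (-ξ))) atTop (nhds A₀)) :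
    Tendsto (fun ξ => -W1 ξ / (ξ * Real.exp (-ξ))) atTop (nhds A₀) := by
  have h1 : Tendsto (fun x => Real.exp (3*x/2) * W x ^2) atTop (nhds 0) := by
    have := (hlim.pow 2).mul (pow_exp_aux 2)
    rw [mul_zero] at this
    refine this.congr' ?_
    filter_upwards [eventually_gt_atTop 0] with x hx
    have : Real.exp (3*x/2) = Real.exp (-x/2) / (Real.exp (-x))^2 := by
      rw [← Real.exp_nat_mul, ← Real.exp_sub]; congr 1; push_cast; ring
    rw [this]
    field_simp
  have h2 : ∀ᶠ x in atTop, Real.exp (3*x/2) * W x ^2 ≤ 1 := 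
    (h1.eventually (gt_mem_nhds one_pos)).mono fun x hx => le_of_lt hx
  obtain ⟨N, hN⟩ := eventually_atTop.1 h2
  have hb := bdd_of_deriv_aux (fun x => Real.exp x * (W x + W1 x)) 
    (fun x => Real.exp x * (W x - g (W x))) (fun x => 2 * K * Real.exp (-x/2)) 
    (fun x => K * Real.exp (-x/2)) N
    (fun x _ => by
      exact ((Real.hasDerivAt_exp x).mul ((hW x).add (hW1 x))).congr_deriv (by
        simp only [Pi.add_apply]; ring))
    (fun x _ => by
      have : HasDerivAt (fun x : ℝ => -x/2) (-1/2) x := (hasDerivAt_id x).neg.div_const 2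
      exact ((this.exp).const_mul (2*K)).congr_deriv (by ring))
    (fun x hx => by
      rw [abs_mul, abs_of_pos (Real.exp_pos x), abs_sub_comm]
      have a1 := hg (W x) ⟨(hm x).1.le, (hm x).2.le⟩
      have a2 := hN x hx
      calc Real.exp x * |g (W x) - W x| ≤ Real.exp x * (K * W x^2) := by gcongr
        _ = K * Real.exp (-x/2) * (Real.exp (3*x/2) * W x ^2) := by
          have : Real.exp x = Real.exp (-x/2) * Real.exp (3*x/2) := by
            rw [← Real.exp_add]; congr 1; ring
          rw [this]; ring
        _ ≤ K * Real.exp (-x/2) * 1 := by gcongr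
        _ = _ := mul_one _)
    (fun x _ => by positivity)
  set B := |Real.exp N * (W N + W1 N)| + 2 * K * Real.exp (-N/2) with hB
  have h3 : Tendsto (fun x => Real.exp x * (W x + W1 x) / x) atTop (nhds 0) := by
    have : Tendsto (fun x : ℝ => B / x) atTop (nhds 0) := tendsto_const_nhds.div_atTop tendsto_id
    refine squeeze_zero_norm' ?_ this
    filter_upwards [eventually_gt_atTop 0, eventually_ge_atTop N] with x hx hx2
    rw [Real.norm_eq_abs, abs_div, abs_of_pos hx]
    gcongr
    exact hb x hx2
  have := hlim.sub h3
  rw [sub_zero] at this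
  refine this.congr' ?_
  filter_upwards [eventually_gt_atTop 0] with x hx
  rw [Real.exp_neg]
  field_simp
  ring

lemma profile_aux (g1 W ψ ψ1 : ℝ → ℝ) (A₀ : ℝ) (hA₀ : 0 < A₀)
    (hWc : Continuous W) (hψ : ∀ x, HasDerivAt ψ (ψ1 x) x)
    (hψ1 : ∀ x, HasDerivAt ψ1 (-2 * ψ1 x - g1 (W x) * ψ x) x)
    (hψ2 : ContDiff ℝ 2 ψ) (hpos : ∀ x, 0 < ψ x) (hWpos : ∀ x, 0 < W x)
    (hlim : Tendsto (fun ξ => W ξ / (ξ * Real.exp (-ξ))) atTop (nhds A₀))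
    (hlim2 : Tendsto (fun ξ => ψ ξ / (ξ * Real.exp (-ξ))) atTop (nhds A₀)) (b : ℝ) :
    ∃ P P1 P2 : ℝ → ℝ, (∀ x, HasDerivAt P (P1 x) x) ∧ (∀ x, HasDerivAt P1 (P2 x) x) ∧
      ContDiff ℝ 2 P ∧ P b = -1 ∧ P1 b = 0 ∧
      (∃ C > 0, ∀ x, b ≤ x → |P x| ≤ C * W x) ∧
      (∃ c > 0, ∀ x, b ≤ x → c * W x ^ 2 ≤ P2 x + 2 * P1 x + g1 (W x) * P x) := by
  have hψc : Continuous ψ := hψ2.continuous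
  set m₁ : ℝ := Real.exp (-b/2) + ψ1 b * Real.exp (2*b) with hm₁
  set m : ℝ → ℝ := fun t => m₁ - Real.exp (-t/2) with hm
  set q : ℝ → ℝ := fun t => m t * Real.exp (-2*t) / ψ t ^ 2 with hq
  set q1 : ℝ → ℝ := fun t => Real.exp (-t/2) / 2 * Real.exp (-2*t) / ψ t ^ 2
    - 2 * m t * Real.exp (-2*t) / ψ t ^ 2 - 2 * m t * Real.exp (-2*t) * ψ1 t / ψ t ^ 3 with hq1
  have hmd : ∀ x, HasDerivAt m (Real.exp (-x/2) / 2) x := by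
    intro x
    have : HasDerivAt (fun x : ℝ => -x/2) (-1/2) x := (hasDerivAt_id x).neg.div_const 2
    exact ((this.exp).const_sub m₁).congr_deriv (by ring)
  have hqd : ∀ x, HasDerivAt q (q1 x) x := by
    intro x
    have h1 : HasDerivAt (fun x : ℝ => -2*x) (-2) x := by
      simpa using (hasDerivAt_id x).const_mul (-2:ℝ)
    have hne := (hpos x).ne'
    refine (((hmd x).mul h1.exp).div ((hψ x).pow 2) (pow_ne_zero 2 hne)).congr_deriv ?_
    simp only [hq1, Pi.mul_apply, Pi.pow_apply]
    field_simp
    push_cast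
    ring
  have hqC : ContDiff ℝ 2 q := by
    have : ContDiff ℝ 2 m := by fun_prop
    apply ContDiff.div
    · fun_prop
    · fun_prop
    · intro x; exact pow_ne_zero 2 (hpos x).ne'
  have hqc := hqC.continuous
  set ρ : ℝ → ℝ := fun x => -1 / ψ b + ∫ t in b..x, q t with hρ
  have hρd : ∀ x, HasDerivAt ρ (q x) x := by
    intro x
    exact (intervalIntegral.integral_hasDerivAt_right (hqc.intervalIntegrable _ _)
      (hqc.stronglyMeasurableAtFilter _ _) hqc.continuousAt).const_add _
  have hρC : ContDiff ℝ 2 ρ := by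
    have e : deriv ρ = q := funext fun x => (hρd x).deriv
    have : ContDiff ℝ (1+1) ρ := by
      rw [contDiff_succ_iff_deriv]
      refine ⟨fun x => (hρd x).differentiableAt, by simp, ?_⟩
      rw [e]; exact hqC.of_le (by norm_num)
    simpa [one_add_one_eq_two] using this
  have hρb : ρ b = -1 / ψ b := by simp [hρ]
  refine ⟨fun x => ψ x * ρ x, fun x => ψ1 x * ρ x + ψ x * q x,
    fun x => (-2 * ψ1 x - g1 (W x) * ψ x) * ρ x + ψ1 x * q x + (ψ1 x * q x + ψ x * q1 x), 
    fun x => (hψ x).mul (hρd x), fun x => ((hψ1 x).mul (hρd x)).add ((hψ x).mul (hqd x)),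
    hψ2.mul hρC, ?_, ?_, ?_, ?_⟩
  · have := (hpos b).ne'
    simp only [hρb]; field_simp
  · have := (hpos b).ne'
    have e : Real.exp (2*b) = (Real.exp (-2*b))⁻¹ := by rw [← Real.exp_neg]; congr 1; ring
    have := (Real.exp_pos (-2*b)).ne'
    simp only [hρb, hq, hm, hm₁, e]; field_simp; ring
  · have hρbd : ∃ C, ∀ᶠ x in atTop, |ρ x| ≤ C := by
      have l1 : Tendsto (fun x : ℝ => Real.exp (-x/2)) atTop (nhds 0) := by
        simpa using pow_exp_aux 0
      have l2 : Tendsto (fun x => x^2 * q x) atTop (nhds ((m₁ - 0) / A₀^2)) := by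
        refine ((tendsto_const_nhds.sub l1).div (hlim2.pow 2) (by positivity)).congr' ?_
        filter_upwards [eventually_gt_atTop 0] with x hx
        have e : Real.exp (-2*x) = (Real.exp (-x))^2 := by
          rw [← Real.exp_nat_mul]; congr 1; push_cast; ring
        have := (hpos x).ne'
        have := (Real.exp_pos (-x)).ne'
        simp only [hq, hm, e, Pi.div_apply]; field_simp
      have l3 := l2.abs.eventually (gt_mem_nhds (lt_add_one _))
      set B := |(m₁ - 0) / A₀^2| + 1 with hB
      have hB0 : 0 ≤ B := by positivity
      obtain ⟨N, hN⟩ := eventually_atTop.1 l3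
      set N' := max N 1 with hN'
      have hp : ∀ x, N' ≤ x → 0 < x := fun x hx => 
        lt_of_lt_of_le one_pos ((le_max_right _ _).trans hx)
      have := bdd_of_deriv_aux ρ q (fun x => B / x) (fun x => B / x^2) N' (fun x _ => hρd x)
        (fun x hx => by
          have hx0 := (hp x hx).ne'
          exact ((hasDerivAt_const x B).div (hasDerivAt_id x) hx0).congr_deriv (by 
            simp only [id]; ring))
        (fun x hx => by
          have hx0 := hp x hx
          have := hN x ((le_max_left _ _).trans hx)
          rw [abs_mul, abs_of_pos (by positivity : 0 < x^2)] at this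
          rw [le_div_iff₀ (by positivity)]
          linarith)
        (fun x hx => by
          have hx0 := hp x hx
          positivity)
      exact ⟨_, eventually_atTop.2 ⟨N', this⟩⟩
    obtain ⟨C1, hC1, h1⟩ := bdd_Ici_aux ρ hρC.continuous hρbd b
    have hrat : ∃ C, ∀ᶠ x in atTop, |ψ x / W x| ≤ C := by
      have l : Tendsto (fun x => ψ x / W x) atTop (nhds (A₀ / A₀)) := by
        refine (hlim2.div hlim hA₀.ne').congr' ?_
        filter_upwards [eventually_gt_atTop 0] with x hx
        have := (hWpos x).ne'
        have := (Real.exp_pos (-x)).ne'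
        simp only [Pi.div_apply]; field_simp
      exact ⟨_, (l.abs.eventually (gt_mem_nhds (lt_add_one _))).mono fun x hx => hx.le⟩
    obtain ⟨C2, hC2, h2⟩ := bdd_Ici_aux _ (hψc.div hWc fun x => (hWpos x).ne') hrat b
    refine ⟨C2 * C1, by positivity, fun x hx => ?_⟩
    have a1 := h1 x hx
    have a2 := h2 x hx
    rw [Pi.div_apply, abs_of_pos (div_pos (hpos x) (hWpos x)), div_le_iff₀ (hWpos x)] at a2
    simp only
    rw [abs_mul, abs_of_pos (hpos x)]
    have := hWpos x
    calc ψ x * |ρ x| ≤ (C2 * W x) * C1 := by gcongr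
      _ = _ := by ring
  · have hbd : ∃ C, ∀ᶠ x in atTop, |Real.exp (5*x/2) * ψ x * W x^2| ≤ C := by
      have l := (hlim2.mul (hlim.pow 2)).mul (pow_exp_aux 3)
      rw [mul_zero] at l
      refine ⟨1, ?_⟩
      have l' := l.abs
      rw [abs_zero] at l'
      filter_upwards [l'.eventually (gt_mem_nhds one_pos), eventually_gt_atTop 0] with x hx hx0
      have e : Real.exp (5*x/2) = Real.exp (-x/2) / (Real.exp (-x))^3 := by
        rw [← Real.exp_nat_mul, ← Real.exp_sub]; congr 1; push_cast; ring
      have : Real.exp (5*x/2) * ψ x * W x^2 = ψ x / (x * Real.exp (-x)) * 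
        (W x / (x * Real.exp (-x)))^2 * (x^3 * Real.exp (-x/2)) := by
        rw [e]
        field_simp
      rw [this]; exact hx.le
    obtain ⟨C, hC, h⟩ := bdd_Ici_aux _ (by fun_prop) hbd b
    refine ⟨1 / (2 * C), by positivity, fun x hx => ?_⟩
    have a := (le_abs_self _).trans (h x hx)
    have hp := hpos x
    have e0 : (-2 * ψ1 x - g1 (W x) * ψ x) * ρ x + ψ1 x * q x + (ψ1 x * q x + ψ x * q1 x)
       + 2 * (ψ1 x * ρ x + ψ x * q x) + g1 (W x) * (ψ x * ρ x) 
       = Real.exp (-x/2) * Real.exp (-2*x) / (2 * ψ x) := by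
      simp only [hq1, hq]
      field_simp
      ring
    have e : Real.exp (-x/2) * Real.exp (-2*x) = (Real.exp (5*x/2))⁻¹ := by
      rw [← Real.exp_add, ← Real.exp_neg]; congr 1; ring
    simp only
    rw [e0, e]
    have := Real.exp_pos (5*x/2)
    rw [inv_eq_one_div, div_div, div_mul_eq_mul_div, div_le_div_iff₀ (by positivity) (by positivity)]
    linarith

lemma derivs_aux (h : ℝ → ℝ) (hC : ContDiffOn ℝ 2 h (Icc 0 1)) :
    (∀ x ∈ Icc (0:ℝ) 1, HasDerivWithinAt h (derivWithin h (Icc 0 1) x) (Icc 0 1) x) ∧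
    (∀ x ∈ Icc (0:ℝ) 1, HasDerivWithinAt (derivWithin h (Icc 0 1))
      (iteratedDerivWithin 2 h (Icc 0 1) x) (Icc 0 1) x) ∧
    ContinuousOn (derivWithin h (Icc 0 1)) (Icc 0 1) ∧
    ContinuousOn (iteratedDerivWithin 2 h (Icc 0 1)) (Icc 0 1) := by
  have hu : UniqueDiffOn ℝ (Icc (0:ℝ) 1) := uniqueDiffOn_Icc one_pos
  have h1 : ContDiffOn ℝ 1 (derivWithin h (Icc 0 1)) (Icc 0 1) :=
    hC.derivWithin hu (by norm_num)
  refine ⟨fun x hx => ((hC.differentiableOn (by norm_num)) x hx).hasDerivWithinAt, 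
    fun x hx => ?_, h1.continuousOn, hC.continuousOn_iteratedDerivWithin (by norm_num) hu⟩
  have := ((h1.differentiableOn (by norm_num)) x hx).hasDerivWithinAt
  rw [iteratedDerivWithin_succ]
  have e : iteratedDerivWithin 1 h (Icc (0:ℝ) 1) = derivWithin h (Icc 0 1) := by
    funext y; rw [iteratedDerivWithin_one]
  rw [e]; exact this

/-- The smooth pieces glue to a super-solution. -/
lemma glue_aux (F : ℝ → ℝ → ℝ) (sδ ε ξ₁ b : ℝ) (W W1 W2 P P1 P2 : ℝ → ℝ)
    (hb : ξ₁ < b)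
    (hW : ∀ x, HasDerivAt W (W1 x) x) (hW1 : ∀ x, HasDerivAt W1 (W2 x) x)
    (hP : ∀ x, HasDerivAt P (P1 x) x) (hP1 : ∀ x, HasDerivAt P1 (P2 x) x)
    (hWC : ContDiff ℝ 2 W) (hPC : ContDiff ℝ 2 P) (hPb : P b = -1) (hP1b : P1 b = 0)
    (hneg : ∀ x, W1 x < 0)
    (hL1 : ∀ x, x ≤ ξ₁ → 1 ≤ W x + ε)
    (hL2 : ∀ x, ξ₁ ≤ x → x ≤ b → W x + ε ≤ 1)
    (hL3 : ∀ x, b ≤ x → W x - ε * P x ≤ 1)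
    (hF1 : F 1 sδ = 0)
    (hS1 : ∀ x, ξ₁ < x → x < b → W2 x + 2 * W1 x + F (W x + ε) sδ ≤ 0)
    (hS2 : ∀ x, b < x → (W2 x - ε * P2 x) + 2 * (W1 x - ε * P1 x) + F (W x - ε * P x) sδ ≤ 0) :
    ∃ S : Finset ℝ,
        ContDiffOn ℝ 2 (fun ξ => min (W ξ - ε * P (max ξ b)) 1) ((S : Set ℝ))ᶜ ∧
        (∀ ξ, ξ ∉ S →
          deriv (deriv (fun ζ => min (W ζ - ε * P (max ζ b)) 1)) ξ +
            2 * deriv (fun ζ => min (W ζ - ε * P (max ζ b)) 1) ξ +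
            F (min (W ξ - ε * P (max ξ b)) 1) sδ ≤ 0) ∧
        (∀ ξ₀ ∈ S, ∃ dp dm : ℝ,
          HasDerivWithinAt (fun ζ => min (W ζ - ε * P (max ζ b)) 1) dp (Ioi ξ₀) ξ₀ ∧
          HasDerivWithinAt (fun ζ => min (W ζ - ε * P (max ζ b)) 1) dm (Iio ξ₀) ξ₀ ∧
          dp ≤ dm) := by
  set G : ℝ → ℝ := fun ζ => min (W ζ - ε * P (max ζ b)) 1 with hG
  have e1 : ∀ x, x ≤ ξ₁ → G x = 1 := by
    intro x hx
    simp only [hG]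
    rw [max_eq_right (hx.trans hb.le), hPb]
    apply min_eq_right
    linarith [hL1 x hx]
  have e2 : ∀ x, ξ₁ ≤ x → x ≤ b → G x = W x + ε := by
    intro x hx hx2
    simp only [hG]
    rw [max_eq_right hx2, hPb, min_eq_left]
    · ring
    · linarith [hL2 x hx hx2]
  have e3 : ∀ x, b ≤ x → G x = W x - ε * P x := by
    intro x hx
    simp only [hG]
    rw [max_eq_left hx, min_eq_left (hL3 x hx)]
  have key : ∀ (H H1 H2 : ℝ → ℝ) (x : ℝ), (∀ x, HasDerivAt H (H1 x) x) → 
      (∀ x, HasDerivAt H1 (H2 x) x) → ContDiff ℝ 2 H → G =ᶠ[nhds x] H →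
      ContDiffAt ℝ 2 G x ∧ deriv (deriv G) x + 2 * deriv G x + F (G x) sδ =
        H2 x + 2 * H1 x + F (H x) sδ := by
    intro H H1 H2 x hH hH1 hHC hev
    refine ⟨hHC.contDiffAt.congr_of_eventuallyEq hev, ?_⟩
    have d1 : deriv H = H1 := funext fun y => (hH y).deriv
    rw [hev.deriv.deriv_eq, hev.deriv_eq, hev.eq_of_nhds, d1, (hH1 x).deriv]
  have hall : ∀ x, x ≠ ξ₁ → x ≠ b → ContDiffAt ℝ 2 G x ∧ 
      deriv (deriv G) x + 2 * deriv G x + F (G x) sδ ≤ 0 := by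
    intro x hx1 hx2
    rcases lt_or_gt_of_ne hx1 with h1 | h1
    · have ev : G =ᶠ[nhds x] fun _ => 1 := by
        filter_upwards [Iio_mem_nhds h1] with y hy using e1 y (le_of_lt hy)
      obtain ⟨c1, c2⟩ := key (fun _ => 1) (fun _ => 0) (fun _ => 0) x (fun y => hasDerivAt_const _ _)
        (fun y => hasDerivAt_const _ _) contDiff_const ev
      exact ⟨c1, by rw [c2, hF1]; simp⟩
    · rcases lt_or_gt_of_ne hx2 with h2 | h2
      · have ev : G =ᶠ[nhds x] fun y => W y + ε := by
          filter_upwards [Ioo_mem_nhds h1 h2] with y hy using e2 y (le_of_lt hy.1) (le_of_lt hy.2)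
        obtain ⟨c1, c2⟩ := key (fun y => W y + ε) W1 W2 x (fun y => (hW y).add_const ε)
          hW1 (hWC.add contDiff_const) ev
        exact ⟨c1, by rw [c2]; exact hS1 x h1 h2⟩
      · have ev : G =ᶠ[nhds x] fun y => W y - ε * P y := by
          filter_upwards [Ioi_mem_nhds h2] with y hy using e3 y (le_of_lt hy)
        obtain ⟨c1, c2⟩ := key (fun y => W y - ε * P y) (fun y => W1 y - ε * P1 y) 
          (fun y => W2 y - ε * P2 y) x (fun y => (hW y).sub ((hP y).const_mul ε))
          (fun y => (hW1 y).sub ((hP1 y).const_mul ε)) (hWC.sub (contDiff_const.mul hPC)) ev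
        exact ⟨c1, by rw [c2]; exact hS2 x h2⟩
  refine ⟨{ξ₁, b}, ?_, ?_, ?_⟩
  · intro x hx
    simp only [Finset.coe_insert, Finset.coe_singleton, mem_compl_iff, mem_insert_iff,
      mem_singleton_iff, not_or] at hx
    exact (hall x hx.1 hx.2).1.contDiffWithinAt
  · intro x hx
    simp only [Finset.mem_insert, Finset.mem_singleton, not_or] at hx
    exact (hall x hx.1 hx.2).2
  · intro x hx
    simp only [Finset.mem_insert, Finset.mem_singleton] at hx
    rcases hx with rfl | rfl
    · refine ⟨W1 x, 0, ?_, ?_, (hneg x).le⟩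
      · refine ((hW x).add_const ε).hasDerivWithinAt.congr_of_eventuallyEq ?_ (e2 x le_rfl hb.le)
        filter_upwards [self_mem_nhdsWithin, mem_nhdsWithin_of_mem_nhds (Iio_mem_nhds hb)] 
          with y hy hy2 using e2 y (le_of_lt hy) (le_of_lt hy2)
      · refine (hasDerivWithinAt_const x _ (1:ℝ)).congr_of_eventuallyEq ?_ (e1 x le_rfl)
        filter_upwards [self_mem_nhdsWithin] with y hy using e1 y (le_of_lt hy)
    · refine ⟨W1 x, W1 x, ?_, ?_, le_rfl⟩
      · have := (hW x).sub ((hP x).const_mul ε)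
        rw [hP1b, mul_zero, sub_zero] at this
        refine this.hasDerivWithinAt.congr_of_eventuallyEq ?_ (e3 x le_rfl)
        filter_upwards [self_mem_nhdsWithin] with y hy using e3 y (le_of_lt hy)
      · refine ((hW x).add_const ε).hasDerivWithinAt.congr_of_eventuallyEq ?_ (e2 x hb.le le_rfl)
        filter_upwards [self_mem_nhdsWithin, mem_nhdsWithin_of_mem_nhds (Ioi_mem_nhds hb)] 
          with y hy hy2 using e2 y (le_of_lt hy2) (le_of_lt hy)

/-- Construction of a super-solution: if the minimal front at the threshold parameter `s*`
decays like `A₀ ξ e^{-ξ}`, then after subtracting a suitable correction `R_w = O(ξ e^{-ξ})`,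
the truncation `min{W* - R_w, 1}` is a (broken) super-solution for the parameter `s* + δ₀`. -/
theorem supersolution_scalar
    (f : ℝ → ℝ → ℝ) (cstar : ℝ → ℝ) (s₁ s₂ : ℝ)
    -- (A1)
    (hA1 : ∀ s, 0 ≤ s →
      ContDiffOn ℝ 2 (fun w => f w s) (Icc 0 1) ∧
      f 0 s = 0 ∧ f 1 s = 0 ∧
      derivWithin (fun w => f w s) (Icc 0 1) 0 = 1 ∧
      derivWithin (fun w => f w s) (Icc 0 1) 1 < 0 ∧
      (∀ w ∈ Ioo (0:ℝ) 1, 0 < f w s))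
    -- (A2)
    (hA2 : ∃ L₀ > (0:ℝ), ∀ n : ℕ, n ≤ 2 → ∀ w ∈ Icc (0:ℝ) 1, ∀ sa sb : ℝ, 0 ≤ sa → 0 ≤ sb →
      |iteratedDerivWithin n (fun w => f w sa) (Icc 0 1) w -
        iteratedDerivWithin n (fun w => f w sb) (Icc 0 1) w| ≤ L₀ * |sa - sb|)
    -- (A3)
    (hA3 : ∀ s sh : ℝ, 0 ≤ s → s < sh →
      (∀ w ∈ Ioo (0:ℝ) 1, f w s < f w sh) ∧
      iteratedDerivWithin 2 (fun w => f w s) (Icc 0 1) 0 <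
        iteratedDerivWithin 2 (fun w => f w sh) (Icc 0 1) 0)
    -- minimal-speed characterization
    (hmin : ∀ s, 0 ≤ s → 2 ≤ cstar s ∧
      ∀ c, (∃ W : ℝ → ℝ, IsFront (fun w => f w s) c W) ↔ cstar s ≤ c)
    -- (A4)
    (hs₁ : 0 < s₁) (hA4 : ∀ w ∈ Icc (0:ℝ) 1, f w s₁ ≤ w) (hc₁ : cstar s₁ = 2)
    -- (A5)
    (hs₂ : s₁ < s₂) (hc₂ : 2 < cstar s₂)
    -- the threshold value s* ∈ [s₁, s₂)
    (sstar : ℝ) (hss₁ : s₁ ≤ sstar) (hss₂ : sstar < s₂)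
    (hthr₁ : ∀ s, 0 ≤ s → s ≤ sstar → cstar s = 2)
    (hthr₂ : ∀ s, sstar < s → 2 < cstar s)
    -- the minimal traveling wave at s*, with speed 2
    (Wstar : ℝ → ℝ) (hWstar : IsFront (fun w => f w sstar) 2 Wstar)
    -- the contradiction hypothesis: W*(ξ)/ (ξ e^{-ξ}) → A₀ > 0
    (A₀ : ℝ) (hA₀ : 0 < A₀)
    (hlim : Tendsto (fun ξ => Wstar ξ / (ξ * Real.exp (-ξ))) atTop (nhds A₀)) :
    ∃ δ₀ > (0:ℝ), ∃ R : ℝ → ℝ, Continuous R ∧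
      (R =O[atTop] fun ξ => ξ * Real.exp (-ξ)) ∧
      (∀ ξ, 0 ≤ min (Wstar ξ - R ξ) 1) ∧
      (∃ ξ, min (Wstar ξ - R ξ) 1 ≠ 0) ∧
      ∃ S : Finset ℝ,
        ContDiffOn ℝ 2 (fun ξ => min (Wstar ξ - R ξ) 1) ((S : Set ℝ))ᶜ ∧
        (∀ ξ, ξ ∉ S →
          deriv (deriv (fun ζ => min (Wstar ζ - R ζ) 1)) ξ +
            2 * deriv (fun ζ => min (Wstar ζ - R ζ) 1) ξ +
            f (min (Wstar ξ - R ξ) 1) (sstar + δ₀) ≤ 0) ∧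
        (∀ ξ₀ ∈ S, ∃ dp dm : ℝ,
          HasDerivWithinAt (fun ζ => min (Wstar ζ - R ζ) 1) dp (Ioi ξ₀) ξ₀ ∧
          HasDerivWithinAt (fun ζ => min (Wstar ζ - R ζ) 1) dm (Iio ξ₀) ξ₀ ∧
          dp ≤ dm) := by
  have hs : 0 ≤ sstar := hs₁.le.trans hss₁
  obtain ⟨hgC, hg0, hg1, hgd0, hgd1, -⟩ := hA1 sstar hs
  obtain ⟨L, hL, hA2⟩ := hA2
  obtain ⟨hWC, hode, hbot, htop, hneg⟩ := hWstar
  set g : ℝ → ℝ := fun w => f w sstar with hg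
  set g1 := derivWithin g (Icc 0 1) with hg1def
  obtain ⟨D1, D2, D3, D4⟩ := derivs_aux g hgC
  obtain ⟨K, hK⟩ := isCompact_Icc.exists_bound_of_continuousOn D4
  have hK0 : 0 ≤ K := (norm_nonneg _).trans (hK 0 (by simp))
  have T1 := taylor_aux g g1 _ K D1 D2 hK
  have T2 : ∀ δ, 0 ≤ δ → ∀ v ∈ Icc (0:ℝ) 1, f v (sstar + δ) ≤ g v + L * δ * v ^ 2 := by
    intro δ hδ v hv
    have hsd : 0 ≤ sstar + δ := by linarith
    obtain ⟨hhC, hh0, -, hhd0, -⟩ := hA1 (sstar + δ) hsd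
    obtain ⟨E1, E2, -, -⟩ := derivs_aux _ hhC
    have := taylor_aux (fun w => f w (sstar + δ) - g w) _ _ (L * δ)
      (fun x hx => (E1 x hx).sub (D1 x hx)) (fun x hx => (E2 x hx).sub (D2 x hx))
      (fun x hx => by
        have := hA2 2 le_rfl x hx (sstar + δ) sstar hsd hs
        rwa [add_sub_cancel_left, abs_of_nonneg hδ] at this) 0 (by simp) v hv
    have hg0' : g 0 = 0 := hg0
    rw [hhd0, ← hg1def, hgd0] at this
    simp only [hh0, hg0', sub_zero, sub_self, zero_mul] at this
    linarith [(abs_le.1 this).2]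
  -- the wave
  have hWd : ∀ x, HasDerivAt Wstar (deriv Wstar x) x := fun x =>
    ((hWC.differentiable (by norm_num)) x).hasDerivAt
  have hdC : ContDiff ℝ 1 (deriv Wstar) := by
    have : ContDiff ℝ (1+1) Wstar := by simpa [one_add_one_eq_two] using hWC
    exact (contDiff_succ_iff_deriv.1 this).2.2
  have hW1d : ∀ x, HasDerivAt (deriv Wstar) (-2 * deriv Wstar x - g (Wstar x)) x := fun x => by
    refine ((hdC.differentiable (by norm_num)) x).hasDerivAt.congr_deriv ?_
    linarith [hode x]
  have hanti : StrictAnti Wstar := strictAnti_of_deriv_neg hneg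
  have hWI : ∀ x, Wstar x ∈ Ioo (0:ℝ) 1 := by
    intro x
    constructor
    · have := hanti.antitone.le_of_tendsto htop (x+1)
      exact this.trans_lt (hanti (by linarith))
    · have := hanti.antitone.ge_of_tendsto hbot (x-1)
      exact (hanti (by linarith : x - 1 < x)).trans_le this
  have hWI' : ∀ x, Wstar x ∈ Icc (0:ℝ) 1 := fun x => Ioo_subset_Icc_self (hWI x)
  have hWn : ∀ x, Icc (0:ℝ) 1 ∈ nhds (Wstar x) := fun x => Icc_mem_nhds (hWI x).1 (hWI x).2
  have hgW : ContDiff ℝ 2 (fun x => g (Wstar x)) := by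
    rw [contDiff_iff_contDiffAt]
    intro x
    exact (hgC.contDiffAt (hWn x)).comp x hWC.contDiffAt
  set ψ : ℝ → ℝ := fun x => -deriv Wstar x with hψ
  set ψ1 : ℝ → ℝ := fun x => -2 * ψ x + g (Wstar x) with hψ1
  have hψd : ∀ x, HasDerivAt ψ (ψ1 x) x := fun x =>
    (hW1d x).neg.congr_deriv (by simp only [hψ1, hψ]; ring)
  have hψC1 : ContDiff ℝ 1 ψ := hdC.neg
  have hψC : ContDiff ℝ 2 ψ := by
    have e : deriv ψ = ψ1 := funext fun x => (hψd x).deriv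
    have : ContDiff ℝ (1+1) ψ := by
      rw [contDiff_succ_iff_deriv]
      refine ⟨fun x => (hψd x).differentiableAt, by simp, ?_⟩
      rw [e]
      exact (contDiff_const.mul hψC1).add (hgW.of_le (by norm_num))
    simpa [one_add_one_eq_two] using this
  have hψ1d : ∀ x, HasDerivAt ψ1 (-2 * ψ1 x - g1 (Wstar x) * ψ x) x := by
    intro x
    have h1 : HasDerivAt g (g1 (Wstar x)) (Wstar x) := (D1 _ (hWI' x)).hasDerivAt (hWn x)
    exact (((hψd x).const_mul (-2)).add (h1.comp x (hWd x))).congr_deriv (by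
      simp only [hψ]; ring)
  have hlim2 := asym_aux g Wstar (deriv Wstar) K A₀ hWd hW1d (fun w hw => by
      have := T1 0 (by simp) w hw
      have hg0' : g 0 = 0 := hg0
      rw [hgd0, hg0'] at this
      simpa using this) hK0 hWI hlim
  -- left region
  have hd1 : g1 1 < 0 := hgd1
  set γ := -g1 1 / 2 with hγ
  have hγ0 : 0 < γ := by rw [hγ]; linarith
  obtain ⟨b, hbγ⟩ : ∃ b, ∀ x, x ≤ b → g1 (Wstar x) ≤ -γ := by
    have c1 : Tendsto g1 (nhdsWithin 1 (Icc 0 1)) (nhds (g1 1)) := D3 1 (by simp)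
    have c2 : Tendsto Wstar atBot (nhdsWithin 1 (Icc 0 1)) :=
      tendsto_nhdsWithin_iff.2 ⟨hbot, Eventually.of_forall hWI'⟩
    have := (c1.comp c2).eventually (gt_mem_nhds (show g1 1 < -γ by rw [hγ]; linarith))
    obtain ⟨b, hb⟩ := eventually_atBot.1 this
    exact ⟨b, fun x hx => (hb x hx).le⟩
  obtain ⟨P, P1, P2, hP, hP1, hPC, hPb, hP1b, ⟨C, hC, hPle⟩, ⟨c, hc, hPc⟩⟩ :=
    profile_aux g1 Wstar ψ ψ1 A₀ hA₀ hWC.continuous hψd hψ1d hψC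
      (fun x => by simp only [hψ]; linarith [hneg x]) (fun x => (hWI x).1) hlim hlim2 b
  obtain ⟨ε, hε, hε1, hε2, hε3, hε4, hε5⟩ : ∃ ε > 0, ε < 1 - Wstar b ∧ C * ε ≤ 1 / 2 ∧
      C * ε ≤ 1 - Wstar b ∧ (K + L) * ε ≤ γ ∧ (K * C ^ 2 + 4 * L) * ε ≤ c := by
    have hb1 : 0 < 1 - Wstar b := by linarith [(hWI b).2]
    set t := min (min (1 - Wstar b) (1/2)) (min γ c) with ht
    have ht0 : 0 < t := by simp only [ht, lt_min_iff]; norm_num; exact ⟨by linarith, hγ0, hc⟩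
    have t1 : t ≤ 1 - Wstar b := (min_le_left _ _).trans (min_le_left _ _)
    have t2 : t ≤ 1/2 := (min_le_left _ _).trans (min_le_right _ _)
    have t3 : t ≤ γ := (min_le_right _ _).trans (min_le_left _ _)
    have t4 : t ≤ c := (min_le_right _ _).trans (min_le_right _ _)
    have hKC : 0 ≤ K * C^2 := by positivity
    set D := 1 + C + K + L + K * C^2 + 4 * L with hD
    have hD0 : 0 < D := by positivity
    have hε : 0 < t / (2 * D) := by positivity
    have hDe : D * (t / (2 * D)) = t / 2 := by field_simp
    set ε := t / (2 * D) with hεdef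
    have hle : ∀ z, z ≤ D → z * ε ≤ t / 2 := fun z hz => by
      rw [← hDe]; exact mul_le_mul_of_nonneg_right hz hε.le
    have z1 := hle 1 (by rw [hD]; linarith)
    have z2 := hle C (by rw [hD]; linarith)
    have z3 := hle (K + L) (by rw [hD]; linarith)
    have z4 := hle (K * C^2 + 4 * L) (by rw [hD]; linarith)
    exact ⟨ε, hε, by linarith, by linarith, by linarith, by linarith, by linarith⟩
  have hPabs : ∀ x, b ≤ x → |ε * P x| ≤ C * ε * Wstar x := by
    intro x hx
    rw [abs_mul, abs_of_pos hε]
    calc ε * |P x| ≤ ε * (C * Wstar x) := by gcongr; exact hPle x hx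
      _ = _ := by ring
  have hPabs2 : ∀ x, b ≤ x → |ε * P x| ≤ Wstar x / 2 := by
    intro x hx
    have := mul_le_mul_of_nonneg_right hε2 (hWI x).1.le
    linarith [hPabs x hx]
  have hL3 : ∀ x, b ≤ x → Wstar x - ε * P x ≤ 1 := by
    intro x hx
    have h1 := (abs_le.1 (hPabs x hx)).1
    have h2 : C * ε * Wstar x ≤ C * ε * 1 := 
      mul_le_mul_of_nonneg_left (hWI x).2.le (by positivity)
    have h3 := hanti.antitone hx
    linarith
  obtain ⟨ξ₁, hξ₁⟩ : ∃ ξ₁, Wstar ξ₁ = 1 - ε := by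
    obtain ⟨a, ha⟩ := (hbot.eventually (lt_mem_nhds (show 1 - ε < 1 by linarith))).exists
    exact mem_range_of_exists_le_of_exists_ge hWC.continuous ⟨b, by linarith⟩ ⟨a, ha.le⟩
  have hξb : ξ₁ < b := by
    rw [← hanti.lt_iff_gt, hξ₁]; linarith
  have hmx : ∀ ξ, P (max ξ b) = -1 ∨ b ≤ ξ ∧ P (max ξ b) = P ξ := by
    intro ξ
    rcases le_total ξ b with h | h
    · left; rw [max_eq_right h, hPb]
    · right; rw [max_eq_left h]; exact ⟨h, rfl⟩
  have hpos : ∀ ξ, 0 < Wstar ξ - ε * P (max ξ b) := by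
    intro ξ
    have := (hWI ξ).1
    rcases hmx ξ with h | ⟨h, h'⟩
    · rw [h]; linarith
    · rw [h']; linarith [(abs_le.1 (hPabs2 ξ h)).2]
  refine ⟨ε ^ 2, by positivity, fun ξ => ε * P (max ξ b), ?_, ?_, ?_, ?_, ?_⟩
  · have := hPC.continuous
    fun_prop
  · have h1 : (fun ξ => ε * P (max ξ b)) =O[atTop] Wstar := by
      refine IsBigO.of_bound 1 ?_
      filter_upwards [eventually_ge_atTop b] with x hx
      rw [max_eq_left hx, Real.norm_eq_abs, Real.norm_eq_abs, abs_of_pos (hWI x).1]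
      linarith [hPabs2 x hx, (hWI x).1]
    refine h1.trans (isBigO_of_div_tendsto_nhds ?_ A₀ hlim)
    filter_upwards [eventually_gt_atTop 0] with x hx hx0
    exact absurd hx0 (by positivity)
  · intro ξ
    exact le_min (hpos ξ).le one_pos.le
  · exact ⟨0, (lt_min (hpos 0) one_pos).ne'⟩
  · refine glue_aux f (sstar + ε^2) ε ξ₁ b Wstar (deriv Wstar) 
      (fun x => -2 * deriv Wstar x - g (Wstar x)) P P1 P2 hξb hWd hW1d hP hP1 hWC hPC hPb hP1b
      hneg ?_ ?_ hL3 (hA1 (sstar + ε^2) (by positivity)).2.2.1 ?_ ?_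
    · intro x hx
      linarith [hanti.antitone hx]
    · intro x hx _
      linarith [hanti.antitone hx]
    · intro x hx hxb
      have hle := hanti.antitone hx.le
      have hv : Wstar x + ε ∈ Icc (0:ℝ) 1 := ⟨by linarith [(hWI x).1], by linarith⟩
      have a1 := T2 (ε^2) (by positivity) _ hv
      have a2 := (abs_le.1 (T1 _ (hWI' x) _ hv)).2
      have a3 := hbγ x hxb.le
      rw [add_sub_cancel_left] at a2
      have a4 : (Wstar x + ε)^2 ≤ 1 := pow_le_one₀ hv.1 hv.2
      have a5 : L * ε^2 * (Wstar x + ε)^2 ≤ L * ε^2 * 1 := by gcongr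
      have a6 : g1 (Wstar x) * ε ≤ -γ * ε := by gcongr
      have a7 : (K + L) * ε * ε ≤ γ * ε := by gcongr
      beta_reduce
      linarith
    · intro x hx
      have hb2 := abs_le.1 (hPabs2 x hx.le)
      have hw := hWI x
      have hv : Wstar x - ε * P x ∈ Icc (0:ℝ) 1 := ⟨by linarith, hL3 x hx.le⟩
      have a1 := T2 (ε^2) (by positivity) _ hv
      have a2 := (abs_le.1 (T1 _ (hWI' x) _ hv)).2
      have a3 := mul_le_mul_of_nonneg_left (hPc x hx.le) hε.le
      have a4 : (Wstar x - ε * P x)^2 ≤ (2 * Wstar x)^2 := by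
        apply pow_le_pow_left₀ hv.1; linarith
      have a5 : L * ε^2 * (Wstar x - ε * P x)^2 ≤ L * ε^2 * (2 * Wstar x)^2 := by gcongr
      have a6 : K * (Wstar x - ε * P x - Wstar x)^2 ≤ K * (C * ε * Wstar x)^2 := by
        have e : (Wstar x - ε * P x - Wstar x)^2 = |ε * P x|^2 := by rw [sq_abs]; ring
        rw [e]
        gcongr
        exact hPabs x hx.le
      have a7 : (K * C ^ 2 + 4 * L) * ε * (ε * Wstar x^2) ≤ c * (ε * Wstar x^2) := by gcongr
      beta_reduce
      linarith
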